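/- Let Λ₁ > Λ₂ > 0 and B > 0, and for ρ > 0 define F(ρ) := (Λ₁·h(ρΛ₁/2) − Λ₂·h(ρΛ₂/2)) / (Λ₁ − Λ₂) − h(ρB/2). Then lim_{ρ → ∞} F(ρ) = (Λ₁·log Λ₁ − Λ₂·log Λ₂) / (Λ₁ − Λ₂) − log B. -/

import Mathlib

open Filter

/-- `h(x) = exp(1/x) · E₁(1/x)` where `E₁(y) = ∫_y^∞ e^{-t}/t dt`. -/
noncomputable def hfun (x : ℝ) : ℝ :=
  Real.exp (1 / x) * ∫ t in Set.Ioi (1 / x), Real.exp (-t) / t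

/-- A divided difference of a differentiable function is continuous. -/
lemma continuous_dslope_of_differentiable {f : ℝ → ℝ} (hf : Differentiable ℝ f) (a : ℝ) :
    Continuous (dslope f a) := by
  rw [← continuousOn_univ]
  exact (continuousOn_dslope univ_mem).2 ⟨hf.continuous.continuousOn, hf a⟩

lemma integrableOn_exp_neg_div_Ioi {y : ℝ} (hy : 0 < y) :
    MeasureTheory.IntegrableOn (fun t : ℝ => Real.exp (-t) / t) (Set.Ioi y) := by
  refine ((integrableOn_exp_neg_Ioi y).const_mul y⁻¹).mono'
    (Measurable.aestronglyMeasurable (by fun_prop)) ?_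
  refine (MeasureTheory.ae_restrict_iff' measurableSet_Ioi).2 (.of_forall fun t ht => ?_)
  have ht' : y < t := ht
  rw [Real.norm_of_nonneg (div_nonneg (Real.exp_pos _).le (hy.trans ht').le), div_eq_inv_mul]
  gcongr

/-- The exponential integral with its logarithmic singularity at `0` split off. -/
lemma integral_exp_neg_div_Ioi_add_log {y : ℝ} (hy : 0 < y) :
    (∫ t in Set.Ioi y, Real.exp (-t) / t) + Real.log y =
      (∫ t in y..1, dslope (fun t : ℝ => Real.exp (-t)) 0 t) +
        ∫ t in Set.Ioi (1 : ℝ), Real.exp (-t) / t := by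
  have hpos : ∀ t ∈ Set.uIcc y 1, 0 < t := fun t ht => (lt_min hy one_pos).trans_le ht.1
  have hinv : IntervalIntegrable (fun t : ℝ => t⁻¹) MeasureTheory.volume y 1 :=
    (continuousOn_id.inv₀ fun t ht => (hpos t ht).ne').intervalIntegrable
  have hsplit := intervalIntegral.integral_interval_add_Ioi (integrableOn_exp_neg_div_Ioi hy)
    (integrableOn_exp_neg_div_Ioi one_pos)
  have hdslope : Continuous (dslope (fun t : ℝ => Real.exp (-t)) 0) :=
    continuous_dslope_of_differentiable (by fun_prop) 0
  have hcongr : ∫ t in y..1, Real.exp (-t) / t =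
      ∫ t in y..1, (dslope (fun t : ℝ => Real.exp (-t)) 0 t + t⁻¹) := by
    refine intervalIntegral.integral_congr fun t ht => ?_
    have ht0 := (hpos t ht).ne'
    simp only [dslope_of_ne _ ht0, slope_def_field, neg_zero, Real.exp_zero, sub_zero]
    field_simp
    ring
  rw [← hsplit, hcongr, intervalIntegral.integral_add (hdslope.intervalIntegrable _ _) hinv,
    integral_inv_of_pos hy one_pos, one_div, Real.log_inv]
  ring

/-- `h(x) - log x` converges as `x → ∞`. -/
lemma exists_tendsto_hfun_sub_log :
    ∃ C : ℝ, Tendsto (fun x : ℝ => hfun x - Real.log x) atTop (nhds C) := by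
  have hdslope : Continuous (dslope (fun t : ℝ => Real.exp (-t)) 0) :=
    continuous_dslope_of_differentiable (by fun_prop) 0
  have hprim : Continuous fun y : ℝ => ∫ t in y..1, dslope (fun t : ℝ => Real.exp (-t)) 0 t := by
    simp_rw [intervalIntegral.integral_symm 1]
    exact (intervalIntegral.continuous_primitive
      (fun _ _ => hdslope.intervalIntegrable _ _) 1).neg
  have hexp : Continuous (dslope Real.exp 0) :=
    continuous_dslope_of_differentiable Real.differentiable_exp 0
  have hlog := Real.continuous_mul_log
  set G : ℝ → ℝ := fun y =>
    Real.exp y * ((∫ t in y..1, dslope (fun t : ℝ => Real.exp (-t)) 0 t) +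
      ∫ t in Set.Ioi (1 : ℝ), Real.exp (-t) / t) - dslope Real.exp 0 y * (y * Real.log y) with hG
  have hGc : Continuous G := by fun_prop
  refine ⟨G 0, ((hGc.tendsto 0).comp tendsto_inv_atTop_zero).congr' ?_⟩
  filter_upwards [eventually_gt_atTop 0] with x hx
  have hy : 0 < x⁻¹ := inv_pos.2 hx
  simp only [Function.comp_apply, hG, hfun, one_div]
  rw [← integral_exp_neg_div_Ioi_add_log hy, dslope_of_ne _ hy.ne', slope_def_field,
    Real.exp_zero, sub_zero, Real.log_inv]
  field_simp
  ring

theorem statement3 (Λ₁ Λ₂ B : ℝ) (h12 : Λ₁ > Λ₂) (h2 : 0 < Λ₂) (hB : 0 < B) :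
    Tendsto (fun ρ : ℝ =>
        (Λ₁ * hfun (ρ * Λ₁ / 2) - Λ₂ * hfun (ρ * Λ₂ / 2)) / (Λ₁ - Λ₂)
          - hfun (ρ * B / 2))
      atTop
      (nhds ((Λ₁ * Real.log Λ₁ - Λ₂ * Real.log Λ₂) / (Λ₁ - Λ₂) - Real.log B)) := by
  obtain ⟨C, hC⟩ := exists_tendsto_hfun_sub_log
  have hshift : ∀ a : ℝ, 0 < a →
      Tendsto (fun ρ : ℝ => hfun (ρ * a / 2) - Real.log (ρ / 2)) atTop
        (nhds (C + Real.log a)) := by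
    intro a ha
    have hscale : Tendsto (fun ρ : ℝ => ρ * a / 2) atTop atTop :=
      (tendsto_id.atTop_mul_const ha).atTop_div_const two_pos
    refine ((hC.comp hscale).add_const (Real.log a)).congr' ?_
    filter_upwards [eventually_gt_atTop 0] with ρ hρ
    rw [Function.comp_apply, mul_div_right_comm, Real.log_mul (by positivity) ha.ne']
    ring
  have hne : Λ₁ - Λ₂ ≠ 0 := (sub_pos.2 h12).ne'
  have hlim := ((((hshift Λ₁ (h2.trans h12)).const_mul Λ₁).sub
    ((hshift Λ₂ h2).const_mul Λ₂)).div_const (Λ₁ - Λ₂)).sub (hshift B hB)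
  convert hlim using 2
  · field_simp
    ring
  · field_simp
    ring
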